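/- arXiv:1108.5708 — 2 statements merged into one kernel-verified Lean document; each statement's English description precedes it below -/
import Mathlib

section
/- Let R be a chain ring with set of zero-divisors Z, and let E be an indecomposable injective R-module such that Z ⊊ E_♯ and E contains a pure uniserial submodule. Then every indecomposable injective R-module G with Z ⊊ G_♯ contains a pure uniserial submodule. -/
open DirectSum


universe u v

/-- `gen M ≤ n`: `M` is generated by at most `n` elements. -/
def GenLE (R : Type u) [Semiring R] (M : Type v) [AddCommMonoid M] [Module R M] (n : ℕ) : Prop :=
  ∃ s : Finset M, s.card ≤ n ∧ Submodule.span R (s : Set M) = ⊤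

/-- The Malcev rank of `M` is at most `n`: every finitely generated submodule of `M`
is generated by at most `n` elements. -/
def MalcevRankLE (R : Type u) [Semiring R] (M : Type v) [AddCommMonoid M] [Module R M]
    (n : ℕ) : Prop :=
  ∀ X : Submodule R M, X.FG →
    ∃ s : Finset M, (s : Set M) ⊆ (X : Set M) ∧ s.card ≤ n ∧ Submodule.span R (s : Set M) = X

/-- An indecomposable (nonzero) module. -/
def IsIndecomposable (R : Type u) [Semiring R] (M : Type v) [AddCommMonoid M] [Module R M] :
    Prop :=
  (∃ x : M, x ≠ 0) ∧ ¬∃ A B : Submodule R M, A ≠ ⊥ ∧ B ≠ ⊥ ∧ IsCompl A B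

/-- A uniform module. -/
def IsUniformModule (R : Type u) [Semiring R] (M : Type v) [AddCommMonoid M] [Module R M] :
    Prop :=
  (∃ x : M, x ≠ 0) ∧ ∀ A B : Submodule R M, A ≠ ⊥ → B ≠ ⊥ → A ⊓ B ≠ ⊥

/-- A pure submodule: tensoring with any module preserves injectivity of the inclusion. -/
def IsPureSubmodule (R : Type u) [CommRing R] {M : Type v} [AddCommGroup M] [Module R M]
    (A : Submodule R M) : Prop :=
  ∀ (C : Type (max u v)) [AddCommGroup C] [Module R C],
    Function.Injective (LinearMap.rTensor C A.subtype)

/-- A uniserial module: submodules are totally ordered. -/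
def IsUniserialModule (R : Type u) [Semiring R] (M : Type v) [AddCommMonoid M] [Module R M] :
    Prop :=
  ∀ A B : Submodule R M, A ≤ B ∨ B ≤ A

/-- A polyserial module: it has a pure-composition series with uniserial factors. -/
def IsPolyserial (R : Type u) [CommRing R] (M : Type v) [AddCommGroup M] [Module R M] : Prop :=
  ∃ (n : ℕ) (F : Fin (n + 1) → Submodule R M),
    F 0 = ⊥ ∧ F (Fin.last n) = ⊤ ∧ StrictMono F ∧
    (∀ i, IsPureSubmodule R (F i)) ∧
    ∀ i : Fin n,
      IsUniserialModule R (↥(F i.succ) ⧸ Submodule.comap (F i.succ).subtype (F i.castSucc))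

/-- A pure-injective module. -/
def IsPureInjective (R : Type u) [CommRing R] (F : Type v) [AddCommGroup F] [Module R F] :
    Prop :=
  ∀ (B : Type (max u v)) [AddCommGroup B] [Module R B] (A : Submodule R B),
    IsPureSubmodule R A → ∀ f : A →ₗ[R] F, ∃ g : B →ₗ[R] F, ∀ a : A, g a = f a

/-- `B` is a pure-essential extension of its submodule `A`. -/
def IsPureEssentialExtension (R : Type u) [CommRing R] {B : Type v} [AddCommGroup B]
    [Module R B] (A : Submodule R B) : Prop :=
  IsPureSubmodule R A ∧
  ∀ K : Submodule R B, K ⊓ A = ⊥ → IsPureSubmodule R (A.map K.mkQ) → K = ⊥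

/-- A maximal ring: every finitely solvable family of congruences is solvable. -/
def IsMaximalCR (R : Type u) [CommRing R] : Prop :=
  ∀ (ι : Type u) (a : ι → R) (A : ι → Ideal R),
    (∀ s : Finset ι, ∃ x : R, ∀ i ∈ s, x - a i ∈ A i) → ∃ x : R, ∀ i, x - a i ∈ A i

/-- An almost maximal ring. -/
def IsAlmostMaximalCR (R : Type u) [CommRing R] : Prop :=
  ∀ (ι : Type u) (a : ι → R) (A : ι → Ideal R), (⨅ i, A i) ≠ ⊥ →
    (∀ s : Finset ι, ∃ x : R, ∀ i ∈ s, x - a i ∈ A i) → ∃ x : R, ∀ i, x - a i ∈ A i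

/-- `M_♯`, the bottom prime ideal associated with `M`, as a set. -/
def sharpSet (R : Type u) [CommRing R] (M : Type v) [AddCommGroup M] [Module R M] : Set R :=
  {s : R | ∃ x : M, x ≠ 0 ∧ s • x = 0}

/-- The set of zero-divisors of `R`. -/
def zeroDivisorsSet (R : Type u) [CommRing R] : Set R :=
  {r : R | ∃ s : R, s ≠ 0 ∧ r * s = 0}

/-- Finite Goldie dimension: every independent family of nonzero submodules is finite. -/
def HasFiniteGoldieDimension (R : Type u) [Semiring R] (M : Type v) [AddCommMonoid M]
    [Module R M] : Prop :=
  ∀ (ι : Type v) (f : ι → Submodule R M), (∀ i, f i ≠ ⊥) →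
    (∀ i, f i ⊓ (⨆ j : {j : ι // j ≠ i}, f j.1) = ⊥) → Finite ι

/-- A superfluous (small) submodule. -/
def IsSuperfluous {R : Type u} [Semiring R] {M : Type v} [AddCommMonoid M] [Module R M]
    (K : Submodule R M) : Prop :=
  ∀ G : Submodule R M, K ⊔ G = ⊤ → G = ⊤

/-- A co-uniform (hollow) module. -/
def IsCouniform (R : Type u) [Semiring R] (M : Type v) [AddCommMonoid M] [Module R M] : Prop :=
  (∃ x : M, x ≠ 0) ∧ ∀ K : Submodule R M, K ≠ ⊤ → IsSuperfluous K

/-- An essential submodule. -/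
def IsEssentialSubmodule {R : Type u} [Semiring R] {M : Type v} [AddCommMonoid M] [Module R M]
    (A : Submodule R M) : Prop :=
  ∀ K : Submodule R M, K ⊓ A = ⊥ → K = ⊥

/-- `M` has dual Goldie dimension `n`. -/
def HasDualGoldieDim (R : Type u) [Ring R] (M : Type v) [AddCommGroup M] [Module R M]
    (n : ℕ) : Prop :=
  ∃ (N : Fin n → Type v) (hab : ∀ i, AddCommGroup (N i)),
    letI := hab
    ∃ hmod : ∀ i, Module R (N i),
      letI := hmod
      ∃ φ : M →ₗ[R] ⨁ i, N i,
        Function.Surjective φ ∧ IsSuperfluous (LinearMap.ker φ) ∧ ∀ i, IsCouniform R (N i)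

/-- If divisibility is total in `R` and `V` is relatively divisible in `M`, then every finite linear
system with right-hand side in `V` that is solvable in `M` is solvable in `V`. -/
theorem exists_solution_mem_of_relativelyDivisible {R : Type*} [CommRing R]
    (hdvd : ∀ a b : R, a ∣ b ∨ b ∣ a) {M : Type*} [AddCommGroup M] [Module R M]
    {V : Submodule R M} (hV : ∀ (r : R) (m : M), r • m ∈ V → ∃ v ∈ V, r • v = r • m)
    {ι : Type*} [Finite ι] (n : ℕ) (B : ι → Fin n → R) (x : Fin n → M)
    (hx : ∀ j, ∑ i, B j i • x i ∈ V) :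
    ∃ z : Fin n → M, (∀ i, z i ∈ V) ∧ ∀ j, ∑ i, B j i • z i = ∑ i, B j i • x i := by
  induction n with
  | zero => exact ⟨0, by simp⟩
  | succ n ih =>
    rcases isEmpty_or_nonempty ι with hι | hι
    · exact ⟨0, fun i ↦ V.zero_mem, fun j ↦ hι.elim j⟩
    obtain ⟨⟨j₀, p⟩, hp⟩ : ∃ q : ι × Fin (n + 1), ∀ q' : ι × Fin (n + 1),
        B q.1 q.2 ∣ B q'.1 q'.2 := by
      have : IsTrans R fun a b ↦ b ∣ a := ⟨fun _ _ _ hab hbc ↦ hbc.trans hab⟩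
      have hD : Directed (fun a b ↦ b ∣ a) fun q : ι × Fin (n + 1) ↦ B q.1 q.2 := fun q q' ↦
        (hdvd (B q.1 q.2) (B q'.1 q'.2)).elim (fun h ↦ ⟨q, dvd_rfl, h⟩) (fun h ↦ ⟨q', h, dvd_rfl⟩)
      exact hD.finite_le id
    choose c hc using fun k ↦ hp (j₀, p.succAbove k)
    choose d hd using fun j ↦ hp (j, p)
    simp only at hc hd
    have hsum (j : ι) (z : Fin (n + 1) → M) : ∑ i, B j i • z i = B j p • z p +
        ∑ k, B j (p.succAbove k) • z (p.succAbove k) := Fin.sum_univ_succAbove _ p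
    have hpivot (z : Fin (n + 1) → M) : ∑ i, B j₀ i • z i =
        B j₀ p • (z p + ∑ k, c k • z (p.succAbove k)) := by
      simp only [hsum, hc, smul_add, Finset.smul_sum, smul_smul]
    have helim (j : ι) (z : Fin (n + 1) → M) : ∑ i, B j i • z i = d j • ∑ i, B j₀ i • z i +
        ∑ k, (B j (p.succAbove k) - d j * B j₀ (p.succAbove k)) • z (p.succAbove k) := by
      simp only [hsum, smul_add, Finset.smul_sum, smul_smul, sub_smul, Finset.sum_sub_distrib]
      rw [hd j, mul_comm]
      abel
    obtain ⟨v, hvV, hv⟩ := hV (B j₀ p) (x p + ∑ k, c k • x (p.succAbove k)) (hpivot x ▸ hx j₀)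
    obtain ⟨z, hzV, hz⟩ := ih (fun j k ↦ B j (p.succAbove k) - d j * B j₀ (p.succAbove k))
      (fun k ↦ x (p.succAbove k)) fun j ↦ by
        have := V.sub_mem (hx j) (V.smul_mem (d j) (hx j₀))
        rwa [helim j, add_sub_cancel_left] at this
    refine ⟨p.insertNth (v - ∑ k, c k • z k) z, fun i ↦ ?_, fun j ↦ ?_⟩
    · induction i using p.succAboveCases with
      | x => simpa using V.sub_mem hvV (V.sum_mem fun k _ ↦ V.smul_mem _ (hzV k))
      | p k => simpa using hzV k
    · rw [helim j x, helim j, ← hz j, hpivot, hpivot, ← hv]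
      simp

open TensorProduct in
/-- Over a ring with total divisibility, relatively divisible submodules are pure. -/
theorem IsPureSubmodule.of_relativelyDivisible {R : Type u} [CommRing R]
    (hdvd : ∀ a b : R, a ∣ b ∨ b ∣ a) {M : Type v} [AddCommGroup M] [Module R M]
    {V : Submodule R M} (hV : ∀ (r : R) (m : M), r • m ∈ V → ∃ v ∈ V, r • v = r • m) :
    IsPureSubmodule R V := by
  intro C _ _
  rw [injective_iff_map_eq_zero]
  intro t ht
  obtain ⟨S, rfl⟩ := TensorProduct.exists_finset t
  rw [← Finset.sum_coe_sort] at ht ⊢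
  simp only [map_sum, LinearMap.rTensor_tmul, Submodule.subtype_apply] at ht
  have hP : (Submodule.span R (Set.range fun s : S ↦ (s.1.1 : M))).FG :=
    Submodule.fg_span (Set.finite_range _)
  obtain ⟨Q, hPQ, hQ, h0⟩ := TensorProduct.eq_zero_of_fg_of_subtype_eq_zero (R := R) hP
    (t := ∑ s : S, (⟨s.1.1, Submodule.subset_span ⟨s, rfl⟩⟩ :
      Submodule.span R (Set.range fun s : S ↦ (s.1.1 : M))) ⊗ₜ[R] s.1.2) (by simpa using ht)
  obtain ⟨n, g, hg⟩ := Submodule.fg_iff_exists_fin_generating_family.mp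
    (Module.Finite.iff_fg.mpr hQ).fg_top
  have hgen (s : S) : ∃ a : Fin n → R, ∑ k, a k • g k =
      ⟨s.1.1, hPQ (Submodule.subset_span ⟨s, rfl⟩)⟩ := by
    rw [← Submodule.mem_span_range_iff_exists_fun, hg]
    trivial
  choose a ha using hgen
  have h0' : ∑ k, g k ⊗ₜ[R] (∑ s : S, a s k • s.1.2) = 0 := by
    rw [← h0]
    have hincl (s : S) : Submodule.inclusion hPQ ⟨s.1.1, Submodule.subset_span ⟨s, rfl⟩⟩ =
        ∑ k, a s k • g k := (ha s).symm
    simp only [map_sum, LinearMap.rTensor_tmul, hincl,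
      TensorProduct.sum_tmul, TensorProduct.tmul_sum, TensorProduct.smul_tmul]
    exact Finset.sum_comm
  obtain ⟨κ, b, y, hy, hb⟩ := TensorProduct.vanishesTrivially_of_sum_tmul_eq_zero R hg h0'
  have haM (s : S) : ∑ k, a s k • (g k : M) = s.1.1 := by
    simpa using congrArg Q.subtype (ha s)
  have hbM (j : Fin κ) : ∑ k, b k j • (g k : M) = 0 := by
    simpa using congrArg Q.subtype (hb j)
  obtain ⟨z, hzV, hz⟩ := exists_solution_mem_of_relativelyDivisible hdvd hV n
    (Sum.elim a fun j k ↦ b k j) (fun k ↦ (g k : M)) (by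
      rintro (s | j)
      · simp [haM]
      · simp [hbM])
  lift z to Fin n → V using hzV
  have hz₁ (s : S) : s.1.1 = ∑ k, a s k • z k := by
    ext
    simpa [haM] using (hz (Sum.inl s)).symm
  have hz₂ (j : Fin κ) : ∑ k, b k j • z k = 0 := by
    ext
    simpa [hbM] using hz (Sum.inr j)
  calc ∑ s : S, s.1.1 ⊗ₜ[R] s.1.2 = ∑ k, z k ⊗ₜ[R] ∑ s : S, a s k • s.1.2 := by
        simp only [hz₁, TensorProduct.sum_tmul, TensorProduct.tmul_sum, TensorProduct.smul_tmul]
        exact Finset.sum_comm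
    _ = ∑ j, (∑ k, b k j • z k) ⊗ₜ[R] y j := by
        simp only [hy, TensorProduct.sum_tmul, TensorProduct.tmul_sum, TensorProduct.smul_tmul]
        exact Finset.sum_comm
    _ = 0 := by simp [hz₂]

/-- Pure submodules are relatively divisible. -/
theorem IsPureSubmodule.exists_smul_eq {R : Type u} [CommRing R] {M : Type v} [AddCommGroup M]
    [Module R M] {U : Submodule R M} (hU : IsPureSubmodule R U) (r : R) (m : M) (u : U)
    (h : r • m = u) : ∃ w : U, r • w = u := by
  let I : Ideal R := Ideal.span {r}
  let C := ULift.{max u v} (R ⧸ I)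
  have hu : u ⊗ₜ[R] (ULift.up 1 : C) = 0 := by
    apply hU C
    have hr : r • (ULift.up 1 : C) = 0 := by
      ext
      simp [I, Algebra.smul_def]
    rw [LinearMap.rTensor_tmul, map_zero, Submodule.subtype_apply, ← h,
      TensorProduct.smul_tmul, hr, TensorProduct.tmul_zero]
  have hq : u ⊗ₜ[R] (1 : R ⧸ I) = 0 := by
    simpa using congrArg (LinearMap.lTensor U (ULift.moduleEquiv : C ≃ₗ[R] R ⧸ I).toLinearMap) hu
  have hmem := congrArg (TensorProduct.tensorQuotEquivQuotSMul U I) hq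
  rw [← map_one (Ideal.Quotient.mk I), TensorProduct.tensorQuotEquivQuotSMul_tmul_mk, one_smul,
    map_zero, Submodule.Quotient.mk_eq_zero, Submodule.ideal_span_singleton_smul,
    Submodule.mem_smul_pointwise_iff_exists] at hmem
  obtain ⟨w, -, hw⟩ := hmem
  exact ⟨w, hw⟩

/-- An injective module contains a solution of `r • e = m` whenever the annihilator of `r` kills
`m`. -/
theorem Module.Injective.exists_smul_eq {R : Type u} [CommRing R] {E : Type u} [AddCommGroup E]
    [Module R E] (hE : Module.Injective R E) {r : R} {m : E}
    (h : ∀ t : R, t * r = 0 → t • m = 0) : ∃ e : E, r • e = m := by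
  let φ := LinearMap.toSpanSingleton R R r
  have hle : LinearMap.ker φ ≤ LinearMap.ker (LinearMap.toSpanSingleton R E m) := fun t ht ↦ by
    simpa using h t (by simpa [φ] using ht)
  obtain ⟨f, hf⟩ := hE.out ((LinearMap.ker φ).liftQ φ le_rfl)
    (LinearMap.ker_eq_bot.mp (Submodule.ker_liftQ_eq_bot' _ _ rfl))
    ((LinearMap.ker φ).liftQ _ hle)
  refine ⟨f 1, ?_⟩
  have := hf (Submodule.Quotient.mk 1)
  simp only [Submodule.liftQ_apply, φ, LinearMap.toSpanSingleton_apply, one_smul] at this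
  rw [← map_smul, smul_eq_mul, mul_one, this]

/-- Every submodule disjoint from `B` is contained in a maximal one. -/
theorem Submodule.exists_le_maximal_disjoint {R M : Type*} [Ring R] [AddCommGroup M] [Module R M]
    {A B : Submodule R M} (h : Disjoint A B) :
    ∃ C, A ≤ C ∧ Maximal (fun K ↦ Disjoint K B) C :=
  zorn_le_nonempty₀ {K | Disjoint K B} (fun c hc hchain _ _ ↦
    ⟨sSup c, hchain.directedOn.disjoint_sSup_left.mpr fun _ hK ↦ hc hK,
      fun _ hK ↦ le_sSup hK⟩) A h

/-- Indecomposable injective modules are uniform. -/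
theorem IsIndecomposable.isUniformModule {R : Type u} [CommRing R] {E : Type u} [AddCommGroup E]
    [Module R E] (hE : Module.Injective R E) (h : IsIndecomposable R E) : IsUniformModule R E := by
  refine ⟨h.1, fun A₀ C₀ hA₀ hC₀ hdisj ↦ h.2 ?_⟩
  rw [← disjoint_iff] at hdisj
  obtain ⟨C, hC₀C, hC⟩ := Submodule.exists_le_maximal_disjoint hdisj.symm
  obtain ⟨A, hA₀A, hA⟩ := Submodule.exists_le_maximal_disjoint hC.prop.symm
  have hCmax (K : Submodule R E) (hCK : C ≤ K) (hK : Disjoint K A) : K ≤ C :=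
    hC.le_of_ge (hK.mono_right hA₀A) hCK
  refine ⟨A, C, ne_bot_of_le_ne_bot hA₀ hA₀A, ne_bot_of_le_ne_bot hC₀ hC₀C, hA.prop, ?_⟩
  have hinj : Function.Injective (C.mkQ ∘ₗ A.subtype) := by
    rw [← LinearMap.ker_eq_bot, LinearMap.ker_comp, Submodule.ker_mkQ]
    exact Submodule.disjoint_iff_comap_eq_bot.mp hA.prop
  obtain ⟨f, hf⟩ := hE.out _ hinj A.subtype
  let ψ := f ∘ₗ C.mkQ
  have hψA (x : E) (hx : x ∈ A) : ψ x = x := hf ⟨x, hx⟩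
  have hψC (x : E) (hx : x ∈ C) : ψ x = 0 := by
    simp [ψ, (Submodule.Quotient.mk_eq_zero C).mpr hx]
  have hcomap : C.comap ψ ≤ C := hCmax _ (fun x hx ↦ by simp [hψC x hx]) <| by
    rw [Submodule.disjoint_def]
    intro x hx hxA
    rw [Submodule.mem_comap, hψA x hxA] at hx
    exact Submodule.disjoint_def.mp hA.prop x hxA hx
  have hrange : LinearMap.range ψ ≤ A := by
    refine hA.le_of_ge ?_ fun x hx ↦ ⟨x, hψA x hx⟩
    rw [Submodule.disjoint_def]
    rintro _ ⟨x, rfl⟩ hx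
    exact hψC x (hcomap hx)
  rw [codisjoint_iff, eq_top_iff]
  intro x _
  have hxA : ψ x ∈ A := hrange ⟨x, rfl⟩
  rw [← add_sub_cancel (ψ x) x]
  refine Submodule.add_mem_sup hxA (hcomap ?_)
  simp [hψA _ hxA]

/-- Let `U` be a uniserial module over a ring with total divisibility, such that `r • w = u` is
solvable in `U` whenever the annihilator of `r` kills `u`, and suppose that a regular element kills
a nonzero element of `U`. Then an injective module `G` in which a regular element kills a nonzero
element receives a nonzero map from `U` whose range has the same solvability property. -/
theorem exists_linearMap_range_divisible {R : Type u} [CommRing R]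
    (hdvd : ∀ a b : R, a ∣ b ∨ b ∣ a) {U : Type u} [AddCommGroup U] [Module R U]
    (hU : IsUniserialModule R U)
    (hdiv : ∀ (r : R) (u : U), (∀ t : R, t * r = 0 → t • u = 0) → ∃ w : U, r • w = u)
    {c : R} (hc : ∀ t, t * c = 0 → t = 0) {x : U} (hx : x ≠ 0) (hcx : c • x = 0)
    {G : Type u} [AddCommGroup G] [Module R G] (hG : Module.Injective R G)
    {a : R} (ha : ∀ t, t * a = 0 → t = 0) {g : G} (hg : g ≠ 0) (hag : a • g = 0) :
    ∃ f : U →ₗ[R] G, f ≠ 0 ∧ ∀ (r : R) (u : U), (∀ t : R, t * r = 0 → t • f u = 0) →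
      ∃ w : U, r • f w = f u := by
  obtain ⟨y, hy⟩ := hdiv a x fun t ht ↦ by rw [ha t ht, zero_smul]
  let φ := LinearMap.toSpanSingleton R U y
  have hle : LinearMap.ker φ ≤ LinearMap.ker (LinearMap.toSpanSingleton R G g) := fun t ht ↦ by
    simp only [LinearMap.mem_ker, LinearMap.toSpanSingleton_apply, φ] at ht ⊢
    obtain ⟨k, rfl⟩ | ⟨k, rfl⟩ := hdvd a t
    · rw [mul_comm, mul_smul, hag, smul_zero]
    · rw [mul_comm, mul_smul, ht, smul_zero] at hy
      exact absurd hy.symm hx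
  obtain ⟨f, hf⟩ := hG.out ((LinearMap.ker φ).liftQ φ le_rfl)
    (LinearMap.ker_eq_bot.mp (Submodule.ker_liftQ_eq_bot' _ _ rfl))
    ((LinearMap.ker φ).liftQ _ hle)
  have hfy : f y = g := by
    have := hf (Submodule.Quotient.mk 1)
    simpa only [Submodule.liftQ_apply, φ, LinearMap.toSpanSingleton_apply, one_smul] using this
  have hker : LinearMap.ker f ≤ Submodule.span R {y} :=
    (hU _ _).resolve_right fun h ↦ hg <| hfy ▸ h (Submodule.mem_span_singleton_self y)
  refine ⟨f, fun h ↦ hg (by rw [← hfy, h, LinearMap.zero_apply]), fun r u hru ↦ ?_⟩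
  by_cases hr : r = 0
  · exact ⟨0, by simpa using (hru 1 (by rw [hr, mul_zero])).symm⟩
  obtain ⟨w, hw⟩ := hdiv r u fun t ht ↦ by
    obtain ⟨s, rfl⟩ : c * a ∣ t := (hdvd (c * a) t).resolve_right fun ⟨k, hk⟩ ↦
      hr <| hc _ <| ha _ <| by
        rw [mul_assoc, hk, mul_left_comm, ← mul_assoc, ht, zero_mul]
    have hs : s * r = 0 := hc _ <| ha _ <| by rw [← ht]; ring
    obtain ⟨k, hk⟩ := Submodule.mem_span_singleton.mp <| hker <|
      show s • u ∈ LinearMap.ker f by rw [LinearMap.mem_ker, map_smul, hru s hs]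
    calc (c * a * s) • u = k • c • a • y := by
          rw [mul_smul, ← hk, smul_comm, mul_smul]
      _ = 0 := by rw [hy, hcx, smul_zero]
  exact ⟨w, by rw [← map_smul, hw]⟩

/-- over a chain ring, if some indecomposable injective module `E` with
`Z ⊊ E_♯` contains a nonzero pure uniserial submodule, then every indecomposable injective
module `G` with `Z ⊊ G_♯` contains a nonzero pure uniserial submodule. -/
theorem stmt12 (R : Type u) [CommRing R] [IsLocalRing R]
    (hchain : ∀ I J : Ideal R, I ≤ J ∨ J ≤ I)
    (E : Type u) [AddCommGroup E] [Module R E]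
    (hinj : Module.Injective R E) (hind : IsIndecomposable R E)
    (hsharp : zeroDivisorsSet R ⊂ sharpSet R E)
    (hpu : ∃ U : Submodule R E, U ≠ ⊥ ∧ IsPureSubmodule R U ∧
      ∀ A B : Submodule R E, A ≤ U → B ≤ U → A ≤ B ∨ B ≤ A) :
    ∀ (G : Type u) [AddCommGroup G] [Module R G],
      Module.Injective R G → IsIndecomposable R G → zeroDivisorsSet R ⊂ sharpSet R G →
      ∃ V : Submodule R G, V ≠ ⊥ ∧ IsPureSubmodule R V ∧
        ∀ A B : Submodule R G, A ≤ V → B ≤ V → A ≤ B ∨ B ≤ A := by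
  intro G _ _ hGinj _ hGsharp
  have hdvd (a b : R) : a ∣ b ∨ b ∣ a := by
    simpa only [Ideal.span_singleton_le_span_singleton] using
      (hchain (Ideal.span {b}) (Ideal.span {a}))
  have hregular {s : R} (hs : s ∉ zeroDivisorsSet R) (t : R) (ht : t * s = 0) : t = 0 := by
    by_contra h
    exact hs ⟨t, h, by rwa [mul_comm]⟩
  obtain ⟨U, hU0, hUpure, hUchain⟩ := hpu
  obtain ⟨c, ⟨x, hx, hcx⟩, hc⟩ := Set.exists_of_ssubset hsharp
  obtain ⟨a, ⟨g, hg, hag⟩, ha⟩ := Set.exists_of_ssubset hGsharp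
  obtain ⟨z, ⟨hzx, hzU⟩, hz⟩ := Submodule.exists_mem_ne_zero_of_ne_bot <|
    (hind.isUniformModule hinj).2 (Submodule.span R {x}) U (by simpa using hx) hU0
  obtain ⟨k, rfl⟩ := Submodule.mem_span_singleton.mp hzx
  have hUser : IsUniserialModule R U := fun A B ↦ by
    simpa only [Submodule.map_le_map_iff_of_injective U.injective_subtype] using
      hUchain _ _ (Submodule.map_subtype_le U A) (Submodule.map_subtype_le U B)
  obtain ⟨f, hf0, hf⟩ := exists_linearMap_range_divisible hdvd hUser
    (fun r u hru ↦ by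
      obtain ⟨e, he⟩ := hinj.exists_smul_eq (r := r) (m := (u : E)) fun t ht ↦ by
        rw [← Submodule.coe_smul, hru t ht, Submodule.coe_zero]
      exact hUpure.exists_smul_eq r e u he)
    (hregular hc) (x := ⟨k • x, hzU⟩) (by simpa using hz)
    (by ext; simp [smul_comm c k x, hcx]) hGinj (hregular ha) hg hag
  refine ⟨LinearMap.range f, LinearMap.range_eq_bot.not.mpr hf0,
    .of_relativelyDivisible hdvd fun r m ⟨u, hu⟩ ↦ ?_, fun A B hA hB ↦ ?_⟩
  · obtain ⟨w, hw⟩ := hf r u fun t ht ↦ by rw [hu, smul_smul, ht, zero_smul]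
    exact ⟨f w, ⟨w, rfl⟩, hw.trans hu⟩
  · rw [← Submodule.map_comap_eq_of_le hA, ← Submodule.map_comap_eq_of_le hB]
    exact (hUser (A.comap f) (B.comap f)).imp (Submodule.map_mono ·) (Submodule.map_mono ·)
end

section
/- Let R be a chain ring with set of zero-divisors Z such that Q = R_Z is strongly discrete, i.e., L² ≠ L for every nonzero prime ideal L of Q. Then every indecomposable injective R-module contains a pure uniserial submodule. -/
open DirectSum


universe u v

/-- If `r • m = 0` implies `r • y = 0`, some linear map into the injective module `E` sends
`m` to `y`. -/
theorem Module.Injective.exists_apply_eq {R : Type u} [CommRing R] {E : Type u} [AddCommGroup E]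
    [Module R E] (hE : Module.Injective R E) {M : Type u} [AddCommGroup M] [Module R M]
    (m : M) (y : E) (h : ∀ r : R, r • m = 0 → r • y = 0) : ∃ f : M →ₗ[R] E, f m = y := by
  let k := LinearMap.ker (LinearMap.toSpanSingleton R M m)
  let i : (R ⧸ k) →ₗ[R] M := k.liftQ (LinearMap.toSpanSingleton R M m) le_rfl
  let g : (R ⧸ k) →ₗ[R] E := k.liftQ (LinearMap.toSpanSingleton R E y) fun r hr => by
    simpa using h r (by simpa [k] using hr)
  have hi : Function.Injective i := by
    rw [← LinearMap.ker_eq_bot]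
    exact Submodule.ker_liftQ_eq_bot _ _ _ le_rfl
  obtain ⟨f, hf⟩ := hE.out i hi g
  refine ⟨f, ?_⟩
  have h1 := hf (k.mkQ 1)
  simp only [i, g, Submodule.mkQ_apply, Submodule.liftQ_apply,
    LinearMap.toSpanSingleton_apply_one] at h1
  exact h1

section ChainRing

variable {R : Type u} [CommRing R]

theorem dvd_or_dvd_of_chain (hchain : ∀ I J : Ideal R, I ≤ J ∨ J ≤ I) (a b : R) :
    a ∣ b ∨ b ∣ a := by
  rcases hchain (Ideal.span {a}) (Ideal.span {b}) with h | h
  · exact Or.inr (Ideal.span_singleton_le_span_singleton.1 h)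
  · exact Or.inl (Ideal.span_singleton_le_span_singleton.1 h)

/-- Among finitely many elements of a chain ring, one divides all the others. -/
theorem exists_mem_forall_dvd_of_chain (hchain : ∀ I J : Ideal R, I ≤ J ∨ J ≤ I) {ι : Type*}
    (s : Finset ι) (hs : s.Nonempty) (a : ι → R) : ∃ k ∈ s, ∀ j ∈ s, a k ∣ a j := by
  classical
  induction hs using Finset.Nonempty.cons_induction with
  | singleton i => exact ⟨i, by simp⟩
  | cons i s hi hs ih =>
    obtain ⟨k, hk, h⟩ := ih
    rcases dvd_or_dvd_of_chain hchain (a i) (a k) with hik | hki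
    · refine ⟨i, by simp, fun j hj => ?_⟩
      rcases Finset.mem_cons.1 hj with rfl | hj
      · exact dvd_rfl
      · exact hik.trans (h j hj)
    · refine ⟨k, by simp [hk], fun j hj => ?_⟩
      rcases Finset.mem_cons.1 hj with rfl | hj
      · exact hki
      · exact h j hj

/-- Any two elements of a localization of a chain ring at a prime are comparable over the
base ring. -/
theorem exists_smul_eq_or_of_chain (hchain : ∀ I J : Ideal R, I ≤ J ∨ J ≤ I) (N : Ideal R)
    [N.IsPrime] (p q : Localization.AtPrime N) :
    (∃ r : R, p = r • q) ∨ ∃ r : R, q = r • p := by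
  obtain ⟨a, s, rfl⟩ := IsLocalization.exists_mk'_eq N.primeCompl p
  obtain ⟨b, t, rfl⟩ := IsLocalization.exists_mk'_eq N.primeCompl q
  rcases dvd_or_dvd_of_chain hchain (a * t) (b * s) with ⟨r, h⟩ | ⟨r, h⟩
  · right
    refine ⟨r, ?_⟩
    rw [IsLocalization.smul_mk', IsLocalization.mk'_eq_iff_eq, mul_comm (s : R), h]
    ring_nf
  · left
    refine ⟨r, ?_⟩
    rw [IsLocalization.smul_mk', IsLocalization.mk'_eq_iff_eq, mul_comm (t : R), h]
    ring_nf

/-- Over a chain ring, a finite system of linear equations with right-hand sides in a relatively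
divisible submodule `U` that is solvable in the ambient module is solvable in `U`. -/
theorem exists_solution_mem_of_relatively_divisible (hchain : ∀ I J : Ideal R, I ≤ J ∨ J ≤ I)
    {M : Type*} [AddCommGroup M] [Module R M] (U : Submodule R M)
    (hdiv : ∀ (a : R) (e : M), a • e ∈ U → ∃ u ∈ U, a • e = a • u)
    {ι κ : Type*} [Fintype κ] (s : Finset ι) (a : ι → κ → R) (e : κ → M)
    (h : ∀ i ∈ s, ∑ j, a i j • e j ∈ U) :
    ∃ e' : κ → U, ∀ i ∈ s, ∑ j, a i j • (e' j : M) = ∑ j, a i j • e j := by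
  classical
  induction hn : s.card generalizing s a with
  | zero =>
    rw [Finset.card_eq_zero] at hn
    exact ⟨0, by simp [hn]⟩
  | succ n ih =>
    have hs : s.Nonempty := Finset.card_pos.1 (by omega)
    rcases isEmpty_or_nonempty κ with hκ | hκ
    · exact ⟨0, by simp⟩
    obtain ⟨⟨k, l⟩, hkl, hmin⟩ := exists_mem_forall_dvd_of_chain hchain
      (s ×ˢ (Finset.univ : Finset κ)) (hs.product Finset.univ_nonempty) fun p => a p.1 p.2
    have hk : k ∈ s := (Finset.mem_product.1 hkl).1
    choose! c hc using fun i (hi : i ∈ s) => hmin (i, l) (by simp [hi])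
    obtain ⟨b, hbl, hb⟩ : ∃ b : κ → R, b l = 1 ∧ ∀ j, a k j = a k l * b j := by
      choose b hb using fun j => hmin (k, j) (by simp [hk])
      refine ⟨Function.update b l 1, Function.update_self .., fun j => ?_⟩
      rcases eq_or_ne j l with rfl | hj
      · simp
      · simpa [hj] using hb j
    simp only at hc
    have hrow : ∀ (y : κ → M) (i : ι), ∑ j, (a i j - c i * a k j) • y j =
        ∑ j, a i j • y j - c i • ∑ j, a k j • y j := fun y i => by
      simp only [sub_smul, mul_smul, Finset.sum_sub_distrib, Finset.smul_sum]
    obtain ⟨e', he'⟩ := ih (s.erase k) (fun i j => a i j - c i * a k j)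
      (fun i hi => by
        rw [hrow]
        exact U.sub_mem (h i (Finset.mem_of_mem_erase hi)) (U.smul_mem _ (h k hk)))
      (by rw [Finset.card_erase_of_mem hk, hn, Nat.add_sub_cancel])
    have hrowk : ∀ y : κ → M, ∑ j, a k j • y j = a k l • ∑ j, b j • y j := fun y => by
      rw [Finset.smul_sum]
      exact Finset.sum_congr rfl fun j _ => by rw [← mul_smul, ← hb]
    obtain ⟨v, hv, hkv⟩ := hdiv (a k l) (∑ j, b j • e j) (hrowk e ▸ h k hk)
    let w : U := ⟨v, hv⟩ - ∑ j, b j • e' j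
    have hadd : ∀ x : κ → R, ∑ j, x j • ((e' j + (Pi.single l w : κ → U) j : U) : M) =
        ∑ j, x j • (e' j : M) + x l • (w : M) := fun x => by
      simp only [Submodule.coe_add, smul_add, Finset.sum_add_distrib]
      congr 1
      rw [Finset.sum_eq_single l (fun j _ hj => by simp [hj]) (by simp), Pi.single_eq_same]
    have hsolk : ∑ j, a k j • ((e' j + (Pi.single l w : κ → U) j : U) : M) =
        ∑ j, a k j • e j := by
      rw [hrowk, hrowk, hkv, hadd, hbl]
      simp [w]
    refine ⟨fun j => e' j + (Pi.single l w : κ → U) j, fun i hi => ?_⟩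
    rcases eq_or_ne i k with rfl | hik
    · exact hsolk
    · have h1 := he' i (Finset.mem_erase.2 ⟨hik, hi⟩)
      have h2 := hadd fun j => a i j - c i * a k j
      have h0 : a i l - c i * a k l = 0 := by rw [hc i hi, mul_comm, sub_self]
      simp only [h0, zero_smul, add_zero] at h2
      rwa [← h2, hrow, hrow, hsolk, sub_left_inj] at h1

/-- Over a chain ring, relatively divisible submodules are pure. -/
theorem isPureSubmodule_of_relatively_divisible (hchain : ∀ I J : Ideal R, I ≤ J ∨ J ≤ I)
    {M : Type v} [AddCommGroup M] [Module R M] (U : Submodule R M)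
    (hdiv : ∀ (a : R) (e : M), a • e ∈ U → ∃ u ∈ U, a • e = a • u) : IsPureSubmodule R U := by
  classical
  intro C _ _
  rw [injective_iff_map_eq_zero]
  intro x hx
  let G : (C →₀ R) →ₗ[R] C := Finsupp.linearCombination R id
  have hG : Function.Surjective G := Finsupp.linearCombination_id_surjective R C
  obtain ⟨x, rfl⟩ := LinearMap.lTensor_surjective U hG x
  have hexact := lTensor_exact M (M := LinearMap.ker G) (LinearMap.exact_subtype_ker_map G) hG
  obtain ⟨y, hy⟩ := (hexact (U.subtype.rTensor (C →₀ R) x)).1 <| by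
    rw [← hx, ← LinearMap.comp_apply, ← LinearMap.comp_apply, LinearMap.lTensor_comp_rTensor,
      LinearMap.rTensor_comp_lTensor]
  obtain ⟨n, e, k, rfl⟩ := TensorProduct.exists_sum_tmul_eq y
  have hcoord : ∀ c, ∑ j, (k j : C →₀ R) c • e j =
      (TensorProduct.finsuppScalarRight R R U C x c : M) := by
    intro c
    have h1 : ∀ z : TensorProduct R U (C →₀ R),
        TensorProduct.finsuppScalarRight R R M C (U.subtype.rTensor (C →₀ R) z) c =
          (TensorProduct.finsuppScalarRight R R U C z c : M) := fun z => by
      induction z with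
      | zero => simp
      | tmul u f => simp
      | add z w hz hw => simp [hz, hw]
    rw [← h1, ← hy]
    simp
  obtain ⟨e', he'⟩ := exists_solution_mem_of_relatively_divisible hchain U hdiv
    (Finset.univ.biUnion fun j => (k j : C →₀ R).support) (fun c j => (k j : C →₀ R) c) e
    fun c _ => hcoord c ▸ Subtype.property _
  have hxe : x = ∑ j, e' j ⊗ₜ[R] (k j : C →₀ R) := by
    apply (TensorProduct.finsuppScalarRight R R U C).injective
    ext c
    rw [← hcoord]
    by_cases hc : c ∈ Finset.univ.biUnion fun j => (k j : C →₀ R).support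
    · rw [← he' c hc]
      simp
    · have : ∀ j, (k j : C →₀ R) c = 0 := by simpa using hc
      simp [this]
  rw [hxe, map_sum]
  refine Finset.sum_eq_zero fun j _ => ?_
  rw [LinearMap.lTensor_tmul, LinearMap.mem_ker.1 (k j).2, TensorProduct.tmul_zero]

/-- The zero-divisors modulo a proper ideal of a chain ring. -/
def zeroDivisorsMod (hchain : ∀ I J : Ideal R, I ≤ J ∨ J ≤ I) (K : Ideal R) (hK : K ≠ ⊤) :
    Ideal R where
  carrier := {r | ∃ a, a ∉ K ∧ r * a ∈ K}
  zero_mem' := ⟨1, fun h => hK ((Ideal.eq_top_iff_one K).2 h), by simp⟩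
  add_mem' := by
    rintro r r' ⟨a, ha, hra⟩ ⟨a', ha', hra'⟩
    rcases dvd_or_dvd_of_chain hchain a a' with ⟨c, rfl⟩ | ⟨c, rfl⟩
    · refine ⟨a * c, ha', ?_⟩
      rw [add_mul, ← mul_assoc]
      exact K.add_mem (K.mul_mem_right _ hra) hra'
    · refine ⟨a' * c, ha, ?_⟩
      rw [add_mul, ← mul_assoc r']
      exact K.add_mem hra (K.mul_mem_right _ hra')
  smul_mem' := by
    rintro c r ⟨a, ha, hra⟩
    exact ⟨a, ha, by rw [smul_eq_mul, mul_assoc]; exact K.mul_mem_left _ hra⟩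

theorem zeroDivisorsMod_isPrime (hchain : ∀ I J : Ideal R, I ≤ J ∨ J ≤ I) (K : Ideal R)
    (hK : K ≠ ⊤) : (zeroDivisorsMod hchain K hK).IsPrime := by
  refine ⟨fun h => ?_, ?_⟩
  · obtain ⟨a, ha, h1⟩ := (Ideal.eq_top_iff_one _).1 h
    exact ha (by simpa using h1)
  · rintro r r' ⟨a, ha, h⟩
    by_cases hr : r' * a ∈ K
    · exact Or.inr ⟨a, ha, hr⟩
    · exact Or.inl ⟨r' * a, hr, by rwa [← mul_assoc]⟩

/-- The elements of a chain ring that annihilate a nonzero element of the module `E`. -/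
def sharpIdeal (hchain : ∀ I J : Ideal R, I ≤ J ∨ J ≤ I) (E : Type v) [AddCommGroup E]
    [Module R E] [Nontrivial E] : Ideal R where
  carrier := {r | ∃ x : E, x ≠ 0 ∧ r • x = 0}
  zero_mem' := by
    obtain ⟨x, hx⟩ := exists_ne (0 : E)
    exact ⟨x, hx, zero_smul _ _⟩
  add_mem' := by
    rintro r r' ⟨x, hx, hrx⟩ ⟨x', hx', hrx'⟩
    rcases dvd_or_dvd_of_chain hchain r r' with ⟨c, rfl⟩ | ⟨c, rfl⟩
    · exact ⟨x, hx, by rw [add_smul, mul_comm, mul_smul, hrx, smul_zero, add_zero]⟩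
    · exact ⟨x', hx', by rw [add_smul, mul_comm, mul_smul, hrx', smul_zero, add_zero]⟩
  smul_mem' := by
    rintro c r ⟨x, hx, hrx⟩
    exact ⟨x, hx, by rw [smul_eq_mul, mul_smul, hrx, smul_zero]⟩

theorem sharpIdeal_isPrime (hchain : ∀ I J : Ideal R, I ≤ J ∨ J ≤ I) (E : Type v)
    [AddCommGroup E] [Module R E] [Nontrivial E] : (sharpIdeal hchain E).IsPrime := by
  refine ⟨fun h => ?_, ?_⟩
  · obtain ⟨x, hx, h1⟩ := (Ideal.eq_top_iff_one _).1 h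
    exact hx (by simpa using h1)
  · rintro r r' ⟨x, hx, h⟩
    by_cases hr : r' • x = 0
    · exact Or.inr ⟨x, hx, hr⟩
    · exact Or.inl ⟨r' • x, hr, by rwa [← mul_smul]⟩

/-- A nonzero prime ideal consisting of zero-divisors is not idempotent if the total ring of
fractions is strongly discrete. -/
theorem mul_self_ne_of_strongly_discrete
    (hsd : ∀ L : Ideal (Localization (nonZeroDivisors R)), L.IsPrime → L ≠ ⊥ → L * L ≠ L)
    (N : Ideal R) [N.IsPrime] (hN : N ≠ ⊥) (hZ : ∀ r ∈ N, r ∉ nonZeroDivisors R) :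
    N * N ≠ N := by
  intro h
  let φ := algebraMap R (Localization (nonZeroDivisors R))
  refine hsd (N.map φ) ?_ ?_ ?_
  · exact IsLocalization.isPrime_of_isPrime_disjoint (nonZeroDivisors R) _ N ‹_›
      (Set.disjoint_left.2 fun r hr hr' => hZ r hr' hr)
  · exact fun h0 => hN ((Ideal.map_eq_bot_iff_of_injective
      (IsLocalization.injective _ le_rfl)).1 h0)
  · rw [← Ideal.map_mul, h]

theorem exists_dvd_mul_of_mul_self_ne (hchain : ∀ I J : Ideal R, I ≤ J ∨ J ≤ I) (N : Ideal R)
    (h : N * N ≠ N) : ∃ p ∈ N, ∀ n ∈ N, p ∣ n ∨ ∃ r ∉ N, p = r * n := by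
  obtain ⟨p, hp, hp'⟩ := SetLike.exists_of_lt (lt_of_le_of_ne Ideal.mul_le_right h)
  refine ⟨p, hp, fun n hn => (dvd_or_dvd_of_chain hchain p n).imp_right ?_⟩
  rintro ⟨r, rfl⟩
  exact ⟨r, fun hr => hp' (mul_comm n r ▸ Ideal.mul_mem_mul hr hn), mul_comm _ _⟩

/-- A prime ideal `N` of the chain ring `R` such that `E` is a module over the image of `R` in
`R_N`, the ring `R_N` has a simple socle generated by `s`, and `N` annihilates some nonzero
element of `E`. -/
theorem exists_prime_socle (hchain : ∀ I J : Ideal R, I ≤ J ∨ J ≤ I)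
    (hsd : ∀ L : Ideal (Localization (nonZeroDivisors R)), L.IsPrime → L ≠ ⊥ → L * L ≠ L)
    (E : Type v) [AddCommGroup E] [Module R E] [Nontrivial E] :
    ∃ N : Ideal R, N.IsPrime ∧ (∀ t ∉ N, ∀ a : R, t * a = 0 → ∀ e : E, a • e = 0) ∧
      (∃ s : R, (∀ t ∉ N, t * s ≠ 0) ∧ ∀ n ∈ N, ∃ t ∉ N, t * (n * s) = 0) ∧
      ∃ x : E, x ≠ 0 ∧ ∀ n ∈ N, n • x = 0 := by
  let P := sharpIdeal hchain E
  have hP : P.IsPrime := sharpIdeal_isPrime hchain E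
  have hPinj : ∀ r ∉ P, ∀ e : E, r • e = 0 → e = 0 := fun r hr e h =>
    by_contra fun he => hr ⟨e, he, h⟩
  let K : Ideal R := RingHom.ker (algebraMap R (Localization.AtPrime P))
  have hKmem : ∀ a, a ∈ K ↔ ∃ t ∉ P, t * a = 0 := fun a => by
    rw [RingHom.mem_ker, IsLocalization.map_eq_zero_iff P.primeCompl]
    exact ⟨fun ⟨t, h⟩ => ⟨t, t.2, h⟩, fun ⟨t, ht, h⟩ => ⟨⟨t, ht⟩, h⟩⟩
  have hK : K ≠ ⊤ := RingHom.ker_ne_top _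
  have h1K : (1 : R) ∉ K := fun h => hK ((Ideal.eq_top_iff_one K).2 h)
  let N := zeroDivisorsMod hchain K hK
  have hN : N.IsPrime := zeroDivisorsMod_isPrime hchain K hK
  have hNK : ∀ t ∉ N, ∀ a, t * a ∈ K → a ∈ K := fun t ht a h =>
    by_contra fun ha => ht ⟨a, ha, h⟩
  have hNP : N ≤ P := by
    rintro r ⟨a, ha, hra⟩
    by_contra hr
    obtain ⟨t, ht, h⟩ := (hKmem _).1 hra
    refine ha ((hKmem _).2 ⟨t * r, fun h => (hP.mem_or_mem h).elim ht hr, by rwa [mul_assoc]⟩)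
  have hNZ : ∀ r ∈ N, r ∉ nonZeroDivisors R := by
    rintro r ⟨a, ha, hra⟩ hr
    obtain ⟨t, ht, h⟩ := (hKmem _).1 hra
    refine ha ((hKmem _).2 ⟨t, ht, (mul_right_mem_nonZeroDivisors_eq_zero_iff hr).1 ?_⟩)
    rw [← h]
    ring
  have hprin : N ≠ ⊥ → ∃ p ∈ N, ∀ n ∈ N, p ∣ n ∨ ∃ r ∉ N, p = r * n := fun h0 =>
    exists_dvd_mul_of_mul_self_ne hchain N (mul_self_ne_of_strongly_discrete hsd N h0 hNZ)
  refine ⟨N, hN, fun t ht a h e => ?_, ?_, ?_⟩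
  · obtain ⟨t', ht', h'⟩ := (hKmem _).1 (hNK t ht a (h ▸ K.zero_mem))
    exact hPinj t' ht' _ (by rw [← mul_smul, h', zero_smul])
  · suffices ∃ s ∉ K, ∀ n ∈ N, n * s ∈ K by
      obtain ⟨s, hs, h⟩ := this
      refine ⟨s, fun t ht h0 => hs (hNK t ht s (h0 ▸ K.zero_mem)), fun n hn => ?_⟩
      obtain ⟨t, ht, h0⟩ := (hKmem _).1 (h n hn)
      exact ⟨t, fun h' => ht (hNP h'), h0⟩
    by_cases h0 : N = ⊥
    · refine ⟨1, h1K, fun n hn => ?_⟩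
      rw [h0, Ideal.mem_bot] at hn
      simp [hn]
    · obtain ⟨p, ⟨a, ha, hpa⟩, hp⟩ := hprin h0
      refine ⟨a, ha, fun n hn => ?_⟩
      rcases hp n hn with ⟨c, rfl⟩ | ⟨r, hr, rfl⟩
      · rw [mul_right_comm]
        exact K.mul_mem_right _ hpa
      · exact hNK r hr _ (by rwa [← mul_assoc])
  · by_cases hPN : P ≤ N
    · by_cases h0 : N = ⊥
      · obtain ⟨x, hx⟩ := exists_ne (0 : E)
        refine ⟨x, hx, fun n hn => ?_⟩
        rw [h0, Ideal.mem_bot] at hn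
        rw [hn, zero_smul]
      · obtain ⟨p, hpN, hp⟩ := hprin h0
        obtain ⟨x, hx, hpx⟩ := hNP hpN
        refine ⟨x, hx, fun n hn => ?_⟩
        rcases hp n hn with ⟨c, rfl⟩ | ⟨r, hr, rfl⟩
        · rw [mul_comm, mul_smul, hpx, smul_zero]
        · exact hPinj r (fun h => hr (hPN h)) _ (by rwa [← mul_smul])
    · obtain ⟨t, ⟨x, hx, htx⟩, ht⟩ := SetLike.not_le_iff_exists.1 hPN
      refine ⟨x, hx, fun n hn => ?_⟩
      rcases dvd_or_dvd_of_chain hchain n t with h | ⟨c, rfl⟩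
      · exact absurd (N.mem_of_dvd h hn) ht
      · rw [mul_comm, mul_smul, htx, smul_zero]

end ChainRing

/-- over a chain ring `R` whose total quotient ring `Q = R_Z` is strongly
discrete (no nonzero idempotent prime ideal), every indecomposable injective module contains a
nonzero pure uniserial submodule. -/
theorem stmt14 (R : Type u) [CommRing R] [IsLocalRing R]
    (hchain : ∀ I J : Ideal R, I ≤ J ∨ J ≤ I)
    (hsd : ∀ L : Ideal (Localization (nonZeroDivisors R)), L.IsPrime → L ≠ ⊥ → L * L ≠ L) :
    ∀ (E : Type u) [AddCommGroup E] [Module R E],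
      Module.Injective R E → IsIndecomposable R E →
      ∃ U : Submodule R E, U ≠ ⊥ ∧ IsPureSubmodule R U ∧
        ∀ A B : Submodule R E, A ≤ U → B ≤ U → A ≤ B ∨ B ≤ A := by
  intro E _ _ hE ⟨⟨x₀, hx₀⟩, _⟩
  have : Nontrivial E := ⟨x₀, 0, hx₀⟩
  obtain ⟨N, hN, hker, ⟨s, hs, hsN⟩, x, hx, hNx⟩ := exists_prime_socle hchain hsd E
  let Q := Localization.AtPrime N
  have hzero : ∀ a : R, algebraMap R Q a = 0 ↔ ∃ t ∉ N, t * a = 0 := fun a => by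
    rw [IsLocalization.map_eq_zero_iff N.primeCompl]
    exact ⟨fun ⟨t, h⟩ => ⟨t, t.2, h⟩, fun ⟨t, ht, h⟩ => ⟨⟨t, ht⟩, h⟩⟩
  have hkill : ∀ a : R, algebraMap R Q a = 0 → ∀ e : E, a • e = 0 := fun a ha => by
    obtain ⟨t, ht, h⟩ := (hzero a).1 ha
    exact hker t ht a h
  have hQ := exists_smul_eq_or_of_chain hchain N
  have hsQ : algebraMap R Q s ≠ 0 := fun h => by
    obtain ⟨t, ht, h⟩ := (hzero s).1 h
    exact hs t ht h
  have hsoc : ∀ z : Q, ¬IsUnit z → z * algebraMap R Q s = 0 := fun z hz => by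
    obtain ⟨a, t, rfl⟩ := IsLocalization.exists_mk'_eq N.primeCompl z
    have ha : a ∈ N := by
      by_contra ha
      exact hz ((IsLocalization.AtPrime.isUnit_mk'_iff Q N a t).2 ha)
    have h0 : algebraMap R Q (a * s) = 0 := (hzero _).2 (hsN a ha)
    rw [← (IsLocalization.map_units Q t).mul_right_eq_zero, ← mul_assoc,
      IsLocalization.mk'_spec', ← map_mul, h0]
  obtain ⟨g, hg⟩ := hE.exists_apply_eq s x fun r hr => hNx r <|
    by_contra fun h => hs r h hr
  have hgs : s • g 1 = x := by rw [← map_smul, smul_eq_mul, mul_one, hg]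
  obtain ⟨f, hf⟩ := hE.exists_apply_eq (1 : Q) (g 1) fun r hr => hkill r
    (by rwa [Algebra.algebraMap_eq_smul_one]) _
  have hfs : f (algebraMap R Q s) = x := by
    rw [Algebra.algebraMap_eq_smul_one, map_smul, hf, hgs]
  have hU : ∀ m n : LinearMap.range f, (∃ r : R, m = r • n) ∨ ∃ r : R, n = r • m := by
    rintro ⟨_, p, rfl⟩ ⟨_, q, rfl⟩
    refine (hQ p q).imp ?_ ?_ <;>
    · rintro ⟨r, rfl⟩
      exact ⟨r, Subtype.ext (map_smul f r _)⟩
  refine ⟨LinearMap.range f, fun h => hx ?_, ?_, fun A B hA hB => ?_⟩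
  · rw [← hfs]
    exact (Submodule.mem_bot R).1 (h ▸ LinearMap.mem_range_self f _)
  · refine isPureSubmodule_of_relatively_divisible hchain _ ?_
    rintro a e ⟨q, hq⟩
    by_cases hdvd : algebraMap R Q a ∣ q
    · obtain ⟨z, rfl⟩ := hdvd
      exact ⟨f z, LinearMap.mem_range_self f z, by rw [← hq, ← Algebra.smul_def, map_smul]⟩
    suffices a • e = 0 from ⟨0, zero_mem _, by rw [this, smul_zero]⟩
    have hq0 : q ≠ 0 := fun h => hdvd (h ▸ dvd_zero _)
    obtain ⟨z, hz⟩ : q ∣ algebraMap R Q a := by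
      rcases hQ q (algebraMap R Q a) with ⟨r, h⟩ | ⟨r, h⟩
      · exact absurd (h ▸ Algebra.smul_def r (algebraMap R Q a) ▸ dvd_mul_left _ _) hdvd
      · exact h ▸ Algebra.smul_def r q ▸ dvd_mul_left _ _
    have hzu : ¬IsUnit z := fun h => hdvd (hz ▸ h.mul_right_dvd.2 dvd_rfl)
    obtain ⟨s', hs'⟩ : q ∣ algebraMap R Q s := by
      rcases hQ q (algebraMap R Q s) with ⟨r, h⟩ | ⟨r, h⟩
      · rw [Algebra.smul_def] at h
        have hr : IsUnit (algebraMap R Q r) := by_contra fun hr => hq0 (h.trans (hsoc _ hr))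
        exact h ▸ hr.mul_left_dvd.2 dvd_rfl
      · exact h ▸ Algebra.smul_def r q ▸ dvd_mul_left _ _
    have has : algebraMap R Q a * s' = 0 := by
      rw [hz, mul_right_comm, ← hs', mul_comm, hsoc z hzu]
    rcases hQ s' 1 with ⟨r, h⟩ | ⟨r, h⟩
    · refine absurd ?_ hx
      rw [← Algebra.algebraMap_eq_smul_one] at h
      rw [← hfs, hs', h, mul_comm, ← Algebra.smul_def, map_smul, hq, ← mul_smul]
      exact hkill _ (by rw [map_mul, mul_comm, ← h, has]) e
    · refine hkill a ?_ e
      rw [← mul_one (algebraMap R Q a), h, mul_smul_comm, has, smul_zero]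
  · by_contra! h
    obtain ⟨a, ha, haB⟩ := SetLike.not_le_iff_exists.1 h.1
    obtain ⟨b, hb, hbA⟩ := SetLike.not_le_iff_exists.1 h.2
    rcases hU ⟨a, hA ha⟩ ⟨b, hB hb⟩ with ⟨r, hr⟩ | ⟨r, hr⟩
    · have : a = r • b := congrArg Subtype.val hr
      exact haB (this ▸ B.smul_mem r hb)
    · have : b = r • a := congrArg Subtype.val hr
      exact hbA (this ▸ A.smul_mem r ha)
end
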